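/- Let ρ be a symmetric probability measure on ℝ which is not the Dirac mass at 0 and which has a finite fifth moment; let σ² be its variance and μ₄ its fourth moment. For each n, let (X_n^1,…,X_n^n) have law μ̃_{n,ρ} and let W be a standard Gaussian random variable independent of (X_n^1,…,X_n^n). Then W/n^{1/4} + Sₙ/(n^{1/4}·√Tₙ) converges in distribution, as n → ∞, to the probability distribution on ℝ with density s ↦ (∫_ℝ exp(−μ₄ z⁴/(12σ⁴)) dz)^{−1} · exp(−μ₄ s⁴/(12σ⁴)). -/

import Mathlib

open MeasureTheory ProbabilityTheory Filter Topology Real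

/-- `Sₙ(x) = x₁ + ⋯ + xₙ`. -/
noncomputable def S (n : ℕ) (x : Fin n → ℝ) : ℝ := ∑ i, x i

/-- `Tₙ(x) = x₁² + ⋯ + xₙ²`. -/
noncomputable def T (n : ℕ) (x : Fin n → ℝ) : ℝ := ∑ i, (x i) ^ 2

/-- The (unnormalized) density `exp((1/2) Sₙ²/Tₙ) 1{Tₙ > 0}` of the Curie-Weiss model
of SOC with respect to `ρ^⊗n`. -/
noncomputable def weight (n : ℕ) (x : Fin n → ℝ) : ℝ :=
  if 0 < T n x then Real.exp (S n x ^ 2 / (2 * T n x)) else 0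

/-- The normalization constant `Zₙ`. -/
noncomputable def Z (ρ : Measure ℝ) (n : ℕ) : ℝ :=
  ∫ x, weight n x ∂(Measure.pi fun _ : Fin n => ρ)

/-- The measure `μ̃_{n,ρ}` on `ℝⁿ` with density `(1/Zₙ) exp((1/2) Sₙ²/Tₙ) 1{Tₙ > 0}`
with respect to `ρ^⊗n`. -/
noncomputable def tildeMu (ρ : Measure ℝ) (n : ℕ) : Measure (Fin n → ℝ) :=
  (ENNReal.ofReal (Z ρ n))⁻¹ •
    (Measure.pi fun _ : Fin n => ρ).withDensity fun x => ENNReal.ofReal (weight n x)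

lemma nonneg_of_hasDerivAt_nonneg {f f' : ℝ → ℝ} (hf : ∀ x, HasDerivAt f (f' x) x)
    (h0 : f 0 = 0) (h : ∀ x, 0 ≤ x → 0 ≤ f' x) {x : ℝ} (hx : 0 ≤ x) : 0 ≤ f x := by
  have hm : MonotoneOn f (Set.Ici 0) := by
    refine monotoneOn_of_hasDerivWithinAt_nonneg (f' := f') (convex_Ici 0)
      (fun y _ => (hf y).continuousAt.continuousWithinAt)
      (fun y _ => (hf y).hasDerivWithinAt) (fun y hy => h y ?_)
    rw [interior_Ici] at hy
    exact le_of_lt hy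
  simpa [h0] using hm Set.self_mem_Ici hx hx

lemma hasDerivAt_sinh_div_cosh (x : ℝ) :
    HasDerivAt (fun y => sinh y / cosh y) (1 - (sinh x / cosh x) ^ 2) x := by
  have hc := (cosh_pos x).ne'
  refine ((hasDerivAt_sinh x).fun_div (hasDerivAt_cosh x) hc).congr_deriv ?_
  field_simp

lemma hasDerivAt_log_cosh (x : ℝ) :
    HasDerivAt (fun y => log (cosh y)) (sinh x / cosh x) x :=
  (hasDerivAt_cosh x).log (cosh_pos x).ne'

lemma sinh_div_cosh_nonneg {x : ℝ} (hx : 0 ≤ x) : 0 ≤ sinh x / cosh x :=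
  div_nonneg (sinh_nonneg_iff.2 hx) (cosh_pos x).le

lemma sinh_div_cosh_le_self {x : ℝ} (hx : 0 ≤ x) : sinh x / cosh x ≤ x := by
  have := nonneg_of_hasDerivAt_nonneg
    (fun y => (hasDerivAt_id y).sub (hasDerivAt_sinh_div_cosh y)) (by simp)
    (fun y _ => by nlinarith [sq_nonneg (sinh y / cosh y)]) hx
  simpa using this

lemma sub_cube_le_sinh_div_cosh {x : ℝ} (hx : 0 ≤ x) : x - x ^ 3 / 3 ≤ sinh x / cosh x := by
  have := nonneg_of_hasDerivAt_nonneg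
    (fun y => (hasDerivAt_sinh_div_cosh y).sub
      ((hasDerivAt_id y).sub ((hasDerivAt_pow 3 y).div_const 3))) (by simp)
    (fun y hy => by
      have := pow_le_pow_left₀ (sinh_div_cosh_nonneg hy) (sinh_div_cosh_le_self hy) 2
      norm_num
      linarith) hx
  simpa using this

lemma sinh_div_cosh_le_quintic {x : ℝ} (hx : 0 ≤ x) :
    sinh x / cosh x ≤ x - x ^ 3 / 3 + 2 * x ^ 5 / 15 := by
  have := nonneg_of_hasDerivAt_nonneg
    (fun y => (((hasDerivAt_id y).sub ((hasDerivAt_pow 3 y).div_const 3)).add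
      (((hasDerivAt_pow 5 y).const_mul 2).div_const 15)).sub (hasDerivAt_sinh_div_cosh y))
    (by simp)
    (fun y hy => by
      have h1 := sub_cube_le_sinh_div_cosh hy
      norm_num
      rcases le_or_gt (y ^ 2) 3 with h | h
      · have h0 : 0 ≤ y - y ^ 3 / 3 := by nlinarith
        have := pow_le_pow_left₀ h0 h1 2
        have h6 : 0 ≤ y ^ 6 := by positivity
        nlinarith
      · nlinarith [sq_nonneg (sinh y / cosh y)]) hx
  simpa using this

/-- The logarithm of `cosh u * exp (-u ^ 2 / 2)`. -/
noncomputable def logCoshDefect (u : ℝ) : ℝ := log (cosh u) - u ^ 2 / 2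

lemma logCoshDefect_abs (u : ℝ) : logCoshDefect |u| = logCoshDefect u := by
  simp [logCoshDefect]

lemma continuous_logCoshDefect : Continuous logCoshDefect := by
  unfold logCoshDefect
  exact (continuous_cosh.log fun x => (cosh_pos x).ne').sub (by fun_prop)

lemma exp_logCoshDefect (u : ℝ) : exp (logCoshDefect u) = cosh u * exp (-(u ^ 2 / 2)) := by
  rw [logCoshDefect, sub_eq_add_neg, exp_add, exp_log (cosh_pos u)]

lemma logCoshDefect_nonpos (u : ℝ) : logCoshDefect u ≤ 0 := by
  rw [logCoshDefect, sub_nonpos, log_le_iff_le_exp (cosh_pos u)]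
  exact cosh_le_exp_half_sq u

lemma neg_pow_four_le_logCoshDefect (u : ℝ) : -(u ^ 4 / 12) ≤ logCoshDefect u := by
  have := nonneg_of_hasDerivAt_nonneg
    (fun y => (hasDerivAt_log_cosh y).sub
      (((hasDerivAt_pow 2 y).div_const 2).sub ((hasDerivAt_pow 4 y).div_const 12))) (by simp)
    (fun y hy => by
      have := sub_cube_le_sinh_div_cosh hy
      norm_num
      linarith) (abs_nonneg u)
  have h4 : |u| ^ 4 = u ^ 4 := by rw [show 4 = 2 * 2 from rfl, pow_mul, sq_abs, ← pow_mul]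
  simp only [Pi.sub_apply, cosh_abs, sq_abs, h4] at this
  rw [logCoshDefect]
  linarith

lemma logCoshDefect_le_sextic (u : ℝ) : logCoshDefect u ≤ -(u ^ 4 / 12) + u ^ 6 / 45 := by
  have := nonneg_of_hasDerivAt_nonneg
    (fun y => ((((hasDerivAt_pow 2 y).div_const 2).sub ((hasDerivAt_pow 4 y).div_const 12)).add
      ((hasDerivAt_pow 6 y).div_const 45)).sub (hasDerivAt_log_cosh y)) (by simp)
    (fun y hy => by
      have := sinh_div_cosh_le_quintic hy
      norm_num
      linarith) (abs_nonneg u)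
  have h4 : |u| ^ 4 = u ^ 4 := by rw [show 4 = 2 * 2 from rfl, pow_mul, sq_abs, ← pow_mul]
  have h6 : |u| ^ 6 = u ^ 6 := by rw [show 6 = 2 * 3 from rfl, pow_mul, sq_abs, ← pow_mul]
  simp only [Pi.sub_apply, Pi.add_apply, cosh_abs, sq_abs, h4, h6] at this
  rw [logCoshDefect]
  linarith

lemma logCoshDefect_le_quintic (u : ℝ) : logCoshDefect u ≤ -(u ^ 4 / 12) + |u| ^ 5 := by
  rw [← logCoshDefect_abs, show u ^ 4 = |u| ^ 4 by
    rw [show 4 = 2 * 2 from rfl, pow_mul, pow_mul, sq_abs]]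
  have hv := abs_nonneg u
  generalize |u| = v at hv
  rcases le_total v 1 with h | h
  · have := logCoshDefect_le_sextic v
    have h5 : v ^ 6 ≤ v ^ 5 := pow_le_pow_of_le_one hv h (by norm_num)
    have : 0 ≤ v ^ 5 := by positivity
    linarith
  · have := logCoshDefect_nonpos v
    have h5 : v ^ 4 ≤ v ^ 5 := pow_le_pow_right₀ h (by norm_num)
    have : 0 ≤ v ^ 5 := by positivity
    linarith

lemma logCoshDefect_le_quadratic (u : ℝ) {δ : ℝ} (h1 : δ ≤ 1) :
    logCoshDefect u ≤ -(δ * u ^ 2 - δ ^ 2) / 40 := by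
  rw [← logCoshDefect_abs, ← sq_abs u]
  have hv := abs_nonneg u
  generalize |u| = v at hv
  rcases le_total v 1 with h | h
  · have h2 := logCoshDefect_le_sextic v
    have h5 : v ^ 6 ≤ v ^ 4 := pow_le_pow_of_le_one hv h (by norm_num)
    nlinarith [sq_nonneg (δ - v ^ 2 / 2), show 0 ≤ v ^ 4 by positivity]
  · have h2 := logCoshDefect_le_sextic 1
    have h3 : cosh v ≤ cosh 1 * exp (v - 1) := by
      have h6 := cosh_add 1 (v - 1)
      rw [add_sub_cancel] at h6
      rw [h6, ← cosh_add_sinh (v - 1), mul_add]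
      have h7 : 0 ≤ sinh (v - 1) := sinh_nonneg_iff.2 (by linarith)
      have h8 := mul_le_mul_of_nonneg_right (sinh_lt_cosh 1).le h7
      linarith
    have h4 := log_le_log (cosh_pos v) h3
    rw [log_mul (cosh_pos 1).ne' (exp_pos _).ne', log_exp] at h4
    rw [logCoshDefect] at h2 ⊢
    have h5 : log (cosh v) - v ^ 2 / 2 ≤ - v ^ 2 / 40 := by
      nlinarith [sq_nonneg (20 * v - 19), sq_nonneg (v - 1)]
    nlinarith [mul_le_mul_of_nonneg_right h1 (sq_nonneg v), sq_nonneg δ]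

section Symmetrization

variable {n : ℕ}

lemma T_nonneg (x : Fin n → ℝ) : 0 ≤ T n x := Finset.sum_nonneg fun _ _ => sq_nonneg _

lemma measurable_S : Measurable (S n) := by unfold S; fun_prop

lemma measurable_T : Measurable (T n) := by unfold T; fun_prop

lemma measurable_weight : Measurable (weight n) := by
  have := @measurable_S n
  have hT := @measurable_T n
  exact Measurable.ite (measurableSet_lt measurable_const hT) (by fun_prop) measurable_const

lemma weight_nonneg (x : Fin n → ℝ) : 0 ≤ weight n x := by
  unfold weight
  split_ifs <;> positivity

lemma S_sq_le (x : Fin n → ℝ) : S n x ^ 2 ≤ n * T n x := by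
  simpa [S, T] using sq_sum_le_card_mul_sum_sq (s := Finset.univ) (f := x)

lemma weight_le (x : Fin n → ℝ) : weight n x ≤ exp (n / 2) := by
  unfold weight
  split_ifs with h
  · rw [exp_le_exp, div_le_div_iff₀ (by positivity) (by norm_num)]
    nlinarith [S_sq_le x]
  · positivity

lemma integral_gaussianReal_shift (f : ℝ → ℝ) {q : ℝ} (hq : 0 < q) (a : ℝ) :
    exp (a ^ 2 / 2) * ∫ w, f (w / q + a / q) ∂gaussianReal 0 1 =
      q / √(2 * π) * ∫ s, f s * exp (q * s * a - (q * s) ^ 2 / 2) := by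
  have h1 := Measure.integral_comp_mul_left
    (fun u => f (u / q) * exp (u * a - u ^ 2 / 2)) q
  have h2 := integral_sub_right_eq_self (μ := volume)
    (fun w => f (w / q + a / q) * exp ((w + a) * a - (w + a) ^ 2 / 2)) a
  simp only [sub_add_cancel, sub_div] at h2
  simp only [mul_div_cancel_left₀ _ hq.ne', smul_eq_mul, abs_of_pos (inv_pos.2 hq)] at h1
  rw [h1, h2, integral_gaussianReal_eq_integral_smul one_ne_zero]
  rw [← integral_const_mul, ← integral_const_mul, ← integral_const_mul]
  refine integral_congr_ae (ae_of_all _ fun w => ?_)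
  have h3 : exp ((w + a) * a - (w + a) ^ 2 / 2) = exp (a ^ 2 / 2) * exp (-w ^ 2 / 2) := by
    rw [← exp_add]; ring_nf
  simp only [gaussianPDFReal, NNReal.coe_one, smul_eq_mul, sub_zero, mul_one, h3]
  field_simp

/-- The unnormalized tilted density times the conditional expectation of the observable `f` given
the spins. -/
noncomputable def tiltedMean (f : ℝ → ℝ) (q : ℝ) (n : ℕ) (x : Fin n → ℝ) : ℝ :=
  weight n x * ∫ w, f (w / q + S n x / (q * √(T n x))) ∂gaussianReal 0 1

/-- The average of `tiltedMean` over all sign changes of the spins, up to a constant factor. -/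
noncomputable def symmetrizedMean (f : ℝ → ℝ) (q : ℝ) (n : ℕ) (x : Fin n → ℝ) : ℝ :=
  if 0 < T n x then ∫ s, f s * exp (∑ i, logCoshDefect (q * s * (x i / √(T n x)))) else 0

lemma tiltedMean_eq (f : ℝ → ℝ) {q : ℝ} (hq : 0 < q) (x : Fin n → ℝ) :
    tiltedMean f q n x = q / √(2 * π) * if 0 < T n x then
      ∫ s, f s * exp (q * s * (S n x / √(T n x)) - (q * s) ^ 2 / 2) else 0 := by
  unfold tiltedMean weight
  split_ifs with h
  · rw [← integral_gaussianReal_shift f hq, div_pow, sq_sqrt h.le, div_div, mul_comm 2 (T n x)]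
    simp only [div_div, mul_comm q]
  · simp

/-- Multiplication of the coordinates by the signs encoded by `ε`. -/
def signChange (ε : Fin n → Bool) (x : Fin n → ℝ) (i : Fin n) : ℝ := if ε i then x i else -x i

lemma T_signChange (ε : Fin n → Bool) (x : Fin n → ℝ) : T n (signChange ε x) = T n x := by
  refine Finset.sum_congr rfl fun i _ => ?_
  unfold signChange
  split_ifs <;> simp

lemma measurePreserving_signChange {ρ : Measure ℝ} [IsProbabilityMeasure ρ]
    (hsymm : ρ.map (fun x => -x) = ρ) (ε : Fin n → Bool) :
    MeasurePreserving (signChange ε) (Measure.pi fun _ => ρ) (Measure.pi fun _ => ρ) := by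
  refine measurePreserving_pi (fun _ => ρ) (fun _ => ρ)
    (f := fun i t => if ε i then t else -t) fun i => ?_
  by_cases h : ε i
  · simp only [h, if_true]
    exact MeasurePreserving.id ρ
  · simpa [h] using ⟨measurable_neg, hsymm⟩

lemma sum_exp_signChange (c : Fin n → ℝ) :
    ∑ ε : Fin n → Bool, exp (∑ i, signChange ε c i) = 2 ^ n * ∏ i, cosh (c i) := by
  have h := Finset.prod_univ_sum (fun _ : Fin n => (Finset.univ : Finset Bool))
    (fun i b => exp (if b then c i else -c i))
  simp only [Fintype.piFinset_univ, Fintype.sum_bool, if_true, Bool.false_eq_true, if_false] at h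
  simp only [exp_sum, signChange]
  rw [← h, ← Fin.prod_const, ← Finset.prod_mul_distrib]
  refine Finset.prod_congr rfl fun i _ => ?_
  rw [cosh_eq]
  ring

lemma sum_sq_div_sqrt_T {x : Fin n → ℝ} (h : 0 < T n x) (t : ℝ) :
    ∑ i, (t * (x i / √(T n x))) ^ 2 = t ^ 2 := by
  simp only [mul_pow, div_pow, sq_sqrt h.le]
  rw [← Finset.mul_sum, ← Finset.sum_div]
  change t ^ 2 * (T n x / T n x) = t ^ 2
  rw [div_self h.ne', mul_one]

lemma exp_sum_logCoshDefect {x : Fin n → ℝ} (h : 0 < T n x) (t : ℝ) :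
    exp (∑ i, logCoshDefect (t * (x i / √(T n x)))) =
      (∏ i, cosh (t * (x i / √(T n x)))) * exp (-(t ^ 2 / 2)) := by
  simp only [exp_sum, exp_logCoshDefect]
  rw [Finset.prod_mul_distrib, ← exp_sum, Finset.sum_neg_distrib, ← Finset.sum_div,
    sum_sq_div_sqrt_T h]

lemma integrable_exp_linear_sub_sq {q : ℝ} (hq : 0 < q) (a : ℝ) :
    Integrable fun s : ℝ => exp (q * s * a - (q * s) ^ 2 / 2) := by
  have h := ((integrable_exp_neg_mul_sq (b := q ^ 2 / 2) (by positivity)).comp_sub_right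
    (a / q)).const_mul (exp (a ^ 2 / 2))
  refine h.congr (ae_of_all _ fun s => ?_)
  simp only [← exp_add]
  congr 1
  field_simp
  ring

lemma sum_tiltedMean_signChange (f : BoundedContinuousFunction ℝ ℝ) {q : ℝ} (hq : 0 < q)
    (x : Fin n → ℝ) :
    ∑ ε : Fin n → Bool, tiltedMean f q n (signChange ε x) =
      2 ^ n * (q / √(2 * π) * symmetrizedMean f q n x) := by
  simp only [tiltedMean_eq _ hq, T_signChange, symmetrizedMean]
  rw [← Finset.mul_sum]
  split_ifs with h
  · rw [← integral_finsetSum _ fun ε _ =>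
      (integrable_exp_linear_sub_sq hq _).bdd_mul f.continuous.aestronglyMeasurable
        (ae_of_all _ f.norm_coe_le_norm), mul_left_comm]
    congr 1
    rw [← integral_const_mul]
    refine integral_congr_ae (ae_of_all _ fun s => ?_)
    simp only [exp_sum_logCoshDefect h]
    rw [← Finset.mul_sum]
    have h1 : ∀ ε : Fin n → Bool, exp (q * s * (S n (signChange ε x) / √(T n x)) - (q * s) ^ 2 / 2)
        = exp (∑ i, signChange ε (fun i => q * s * (x i / √(T n x))) i) *
          exp (-((q * s) ^ 2 / 2)) := by
      intro ε
      rw [← exp_add, ← sub_eq_add_neg, S, Finset.sum_div, Finset.mul_sum]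
      congr 2
      refine Finset.sum_congr rfl fun i _ => ?_
      unfold signChange
      split_ifs <;> ring
    simp only [h1]
    rw [← Finset.sum_mul, sum_exp_signChange]
    ring
  · simp

lemma stronglyMeasurable_tiltedMean (f : BoundedContinuousFunction ℝ ℝ) (q : ℝ) :
    StronglyMeasurable (tiltedMean f q n) := by
  have hS := @measurable_S n
  have hT := @measurable_T n
  have hf := f.continuous.measurable
  have h : Measurable fun p : (Fin n → ℝ) × ℝ => f (p.2 / q + S n p.1 / (q * √(T n p.1))) := by
    fun_prop
  exact measurable_weight.stronglyMeasurable.mul h.stronglyMeasurable.integral_prod_right'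

lemma norm_integral_gaussianReal_le (f : BoundedContinuousFunction ℝ ℝ) (g : ℝ → ℝ) :
    ‖∫ w, f (g w) ∂gaussianReal 0 1‖ ≤ ‖f‖ := by
  simpa using norm_integral_le_of_norm_le_const (μ := gaussianReal 0 1)
    (ae_of_all _ fun w => f.norm_coe_le_norm (g w))

lemma integrable_tiltedMean (ρ : Measure ℝ) [IsProbabilityMeasure ρ]
    (f : BoundedContinuousFunction ℝ ℝ) (q : ℝ) :
    Integrable (tiltedMean f q n) (Measure.pi fun _ => ρ) := by
  refine Integrable.of_bound (stronglyMeasurable_tiltedMean f q).aestronglyMeasurable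
    (exp (n / 2) * ‖f‖) (ae_of_all _ fun x => ?_)
  rw [tiltedMean, norm_mul, Real.norm_of_nonneg (weight_nonneg x)]
  exact mul_le_mul (weight_le x) (norm_integral_gaussianReal_le _ _) (norm_nonneg _)
    (exp_pos _).le

lemma measurable_signChange (ε : Fin n → Bool) : Measurable (signChange ε) := by
  refine measurable_pi_lambda _ fun i => ?_
  unfold signChange
  split_ifs <;> fun_prop

lemma stronglyMeasurable_symmetrizedMean (f : BoundedContinuousFunction ℝ ℝ) {q : ℝ}
    (hq : 0 < q) : StronglyMeasurable (symmetrizedMean f q n) := by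
  have h : symmetrizedMean f q n = fun x => (2 ^ n * (q / √(2 * π)))⁻¹ *
      ∑ ε : Fin n → Bool, tiltedMean f q n (signChange ε x) := by
    funext x
    rw [sum_tiltedMean_signChange f hq, ← mul_assoc (2 ^ n),
      inv_mul_cancel_left₀ (by positivity)]
  rw [h]
  have := fun ε => (stronglyMeasurable_tiltedMean (n := n) f q).measurable.comp
    (measurable_signChange ε)
  exact ((Finset.measurable_fun_sum _ fun ε _ => this ε).const_mul _).stronglyMeasurable

lemma integral_tiltedMean {ρ : Measure ℝ} [IsProbabilityMeasure ρ]
    (hsymm : ρ.map (fun x => -x) = ρ) (f : BoundedContinuousFunction ℝ ℝ) {q : ℝ} (hq : 0 < q) :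
    ∫ x, tiltedMean f q n x ∂(Measure.pi fun _ => ρ) =
      q / √(2 * π) * ∫ x, symmetrizedMean f q n x ∂(Measure.pi fun _ => ρ) := by
  have h1 : ∀ ε : Fin n → Bool, ∫ x, tiltedMean f q n (signChange ε x) ∂(Measure.pi fun _ => ρ) =
      ∫ x, tiltedMean f q n x ∂(Measure.pi fun _ => ρ) := fun ε => by
    conv_rhs => rw [← (measurePreserving_signChange hsymm ε).map_eq]
    rw [integral_map (measurable_signChange ε).aemeasurable
      (stronglyMeasurable_tiltedMean f q).aestronglyMeasurable]
  have h2 : ∫ x, ∑ ε : Fin n → Bool, tiltedMean f q n (signChange ε x) ∂(Measure.pi fun _ => ρ) =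
      2 ^ n * ∫ x, tiltedMean f q n x ∂(Measure.pi fun _ => ρ) := by
    have h3 : ∀ ε : Fin n → Bool, Integrable (fun x => tiltedMean f q n (signChange ε x))
        (Measure.pi fun _ => ρ) := fun ε =>
      (measurePreserving_signChange hsymm ε).integrable_comp_of_integrable
        (integrable_tiltedMean ρ f q)
    rw [integral_finsetSum _ fun ε _ => h3 ε]
    simp [h1]
  simp only [sum_tiltedMean_signChange f hq, integral_const_mul] at h2
  exact (mul_left_cancel₀ (by positivity) h2).symm

end Symmetrization

lemma integrable_exp_quadratic : Integrable fun s : ℝ => exp ((1 - s ^ 2) / 40) := by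
  refine ((integrable_exp_neg_mul_sq (b := 1 / 40) (by norm_num)).const_mul (exp (1 / 40))).congr
    (ae_of_all _ fun s => ?_)
  simp only [← exp_add]
  congr 1
  ring

lemma sum_logCoshDefect_le {n : ℕ} {q : ℝ} (hq1 : 1 ≤ q) (hqn : q ^ 4 = n) {x : Fin n → ℝ}
    (h : 0 < T n x) (s : ℝ) :
    ∑ i, logCoshDefect (q * s * (x i / √(T n x))) ≤ (1 - s ^ 2) / 40 := by
  have hq : 0 < q := by linarith
  calc ∑ i, logCoshDefect (q * s * (x i / √(T n x)))
      ≤ ∑ i, -((q ^ 2)⁻¹ * (q * s * (x i / √(T n x))) ^ 2 - (q ^ 2)⁻¹ ^ 2) / 40 :=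
        Finset.sum_le_sum fun i _ => logCoshDefect_le_quadratic _
          (inv_le_one_of_one_le₀ (one_le_pow₀ hq1))
    _ = (1 - s ^ 2) / 40 := by
        rw [← Finset.sum_div, Finset.sum_neg_distrib, Finset.sum_sub_distrib, ← Finset.mul_sum,
          sum_sq_div_sqrt_T h, Finset.sum_const, Finset.card_univ, Fintype.card_fin, nsmul_eq_mul,
          ← hqn]
        field_simp
        ring

lemma norm_mul_exp_sum_le (f : BoundedContinuousFunction ℝ ℝ) {n : ℕ} {q : ℝ} (hq1 : 1 ≤ q)
    (hqn : q ^ 4 = n) {x : Fin n → ℝ} (h : 0 < T n x) (s : ℝ) :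
    ‖f s * exp (∑ i, logCoshDefect (q * s * (x i / √(T n x))))‖ ≤
      ‖f‖ * exp ((1 - s ^ 2) / 40) := by
  rw [norm_mul, Real.norm_of_nonneg (exp_pos _).le]
  exact mul_le_mul (f.norm_coe_le_norm s) (exp_le_exp.2 (sum_logCoshDefect_le hq1 hqn h s))
    (exp_pos _).le (norm_nonneg f)

lemma norm_symmetrizedMean_le (f : BoundedContinuousFunction ℝ ℝ) {n : ℕ} {q : ℝ} (hq1 : 1 ≤ q)
    (hqn : q ^ 4 = n) (x : Fin n → ℝ) :
    ‖symmetrizedMean f q n x‖ ≤ ∫ s : ℝ, ‖f‖ * exp ((1 - s ^ 2) / 40) := by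
  unfold symmetrizedMean
  split_ifs with h
  · exact norm_integral_le_of_norm_le (integrable_exp_quadratic.const_mul _)
      (ae_of_all _ (norm_mul_exp_sum_le f hq1 hqn h))
  · rw [norm_zero]
    positivity

lemma rpow_quarter_pow_four (n : ℕ) : ((n : ℝ) ^ (1 / 4 : ℝ)) ^ 4 = n := by
  rw [← rpow_natCast, ← rpow_mul n.cast_nonneg]
  norm_num

lemma one_le_rpow_quarter {n : ℕ} (hn : 1 ≤ n) : 1 ≤ (n : ℝ) ^ (1 / 4 : ℝ) :=
  one_le_rpow (by exact_mod_cast hn) (by norm_num)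

lemma tendsto_rpow_quarter : Tendsto (fun n : ℕ => (n : ℝ) ^ (1 / 4 : ℝ)) atTop atTop :=
  (tendsto_rpow_atTop (by norm_num)).comp tendsto_natCast_atTop_atTop

lemma T_eq_sum_range (n : ℕ) (x : ℕ → ℝ) :
    T n (fun i => x i) = ∑ i ∈ Finset.range n, x i ^ 2 := by
  rw [T, Finset.sum_range fun i => x i ^ 2]

/-- The sequence `x` has limiting empirical second and fourth moments `a`, `b`, and a limiting
empirical absolute fifth moment. -/
structure HasEmpiricalMoments (x : ℕ → ℝ) (a b : ℝ) : Prop where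
  pos : 0 < a
  second : Tendsto (fun n : ℕ => (∑ i ∈ Finset.range n, x i ^ 2) / n) atTop (𝓝 a)
  fourth : Tendsto (fun n : ℕ => (∑ i ∈ Finset.range n, x i ^ 4) / n) atTop (𝓝 b)
  fifth : ∃ c, Tendsto (fun n : ℕ => (∑ i ∈ Finset.range n, |x i| ^ 5) / n) atTop (𝓝 c)

namespace HasEmpiricalMoments

variable {x : ℕ → ℝ} {a b : ℝ}

lemma eventually_T_pos (hx : HasEmpiricalMoments x a b) :
    ∀ᶠ n : ℕ in atTop, 1 ≤ n ∧ 0 < T n fun i => x i := by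
  filter_upwards [hx.second.eventually_const_lt hx.pos, eventually_ge_atTop 1] with n h hn
  rw [T_eq_sum_range]
  have hn' : (0 : ℝ) < n := by exact_mod_cast hn
  exact ⟨hn, (div_pos_iff_of_pos_right hn').1 h⟩

lemma tendsto_sum_logCoshDefect (hx : HasEmpiricalMoments x a b) (s : ℝ) :
    Tendsto (fun n : ℕ => ∑ i : Fin n,
      logCoshDefect ((n : ℝ) ^ (1 / 4 : ℝ) * s * (x i / √(T n fun i => x i))))
      atTop (𝓝 (-(b * s ^ 4 / (12 * a ^ 2)))) := by
  obtain ⟨c, hc⟩ := hx.fifth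
  set A2 := fun n : ℕ => (∑ i ∈ Finset.range n, x i ^ 2) / n
  set A4 := fun n : ℕ => (∑ i ∈ Finset.range n, x i ^ 4) / n
  set A5 := fun n : ℕ => (∑ i ∈ Finset.range n, |x i| ^ 5) / n
  have ha := hx.pos
  have hmain : Tendsto (fun n => -(A4 n * s ^ 4 / (12 * A2 n ^ 2))) atTop
      (𝓝 (-(b * s ^ 4 / (12 * a ^ 2)))) :=
    ((hx.fourth.mul_const _).div ((hx.second.pow 2).const_mul 12) (by positivity)).neg
  have herr : Tendsto (fun n : ℕ => |s| ^ 5 * (A5 n / √(A2 n) ^ 5) * ((n : ℝ) ^ (1 / 4 : ℝ))⁻¹)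
      atTop (𝓝 0) := by
    have h := ((hc.div (hx.second.sqrt.pow 5) (by positivity)).const_mul (|s| ^ 5)).mul
      (tendsto_inv_atTop_zero.comp tendsto_rpow_quarter)
    rwa [mul_zero] at h
  have hupper := hmain.add herr
  rw [add_zero] at hupper
  have hkey : ∀ᶠ n : ℕ in atTop,
      (∑ i : Fin n, ((n : ℝ) ^ (1 / 4 : ℝ) * s * (x i / √(T n fun i => x i))) ^ 4
        = A4 n * s ^ 4 / A2 n ^ 2) ∧
      (∑ i : Fin n, |(n : ℝ) ^ (1 / 4 : ℝ) * s * (x i / √(T n fun i => x i))| ^ 5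
        = |s| ^ 5 * (A5 n / √(A2 n) ^ 5) * ((n : ℝ) ^ (1 / 4 : ℝ))⁻¹) := by
    filter_upwards [hx.eventually_T_pos] with n ⟨hn, hT⟩
    have hq := one_le_rpow_quarter hn
    have hqn := rpow_quarter_pow_four n
    set q := (n : ℝ) ^ (1 / 4 : ℝ)
    have hq0 : 0 < q := by linarith
    have hTA : T n (fun i => x i) = q ^ 4 * A2 n := by
      rw [T_eq_sum_range]
      simp only [A2, ← hqn]
      field_simp
    have hA2 : 0 < A2 n := by
      rw [hTA] at hT
      exact (mul_pos_iff_of_pos_left (by positivity)).1 hT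
    have hsqrt : √(T n fun i => x i) = q ^ 2 * √(A2 n) := by
      rw [hTA, sqrt_mul (by positivity), show q ^ 4 = (q ^ 2) ^ 2 by ring,
        sqrt_sq (by positivity)]
    have hr0 : 0 < √(A2 n) := sqrt_pos.2 hA2
    have hr : A2 n = √(A2 n) ^ 2 := (sq_sqrt hA2.le).symm
    constructor
    · simp only [hsqrt, mul_pow, div_pow]
      rw [← Finset.mul_sum, ← Finset.sum_div, ← Finset.sum_range fun i => x i ^ 4]
      conv_rhs => rw [hr]
      simp only [A4, ← hqn]
      field_simp
    · simp only [hsqrt, abs_mul, abs_div, abs_of_pos hq0, abs_of_pos hr0, abs_pow, mul_pow,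
        div_pow]
      rw [← Finset.mul_sum, ← Finset.sum_div, ← Finset.sum_range fun i => |x i| ^ 5]
      simp only [A5, ← hqn]
      field_simp
  refine tendsto_of_tendsto_of_tendsto_of_le_of_le' hmain hupper ?_ ?_
  · filter_upwards [hkey] with n ⟨h4, _⟩
    calc -(A4 n * s ^ 4 / (12 * A2 n ^ 2)) = -((A4 n * s ^ 4 / A2 n ^ 2) / 12) := by
          rw [div_div, mul_comm (12 : ℝ)]
      _ = _ := by rw [← h4, Finset.sum_div, ← Finset.sum_neg_distrib]
      _ ≤ _ := Finset.sum_le_sum fun i _ => neg_pow_four_le_logCoshDefect _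
  · filter_upwards [hkey] with n ⟨h4, h5⟩
    refine (Finset.sum_le_sum fun i _ => logCoshDefect_le_quintic _).trans_eq ?_
    rw [Finset.sum_add_distrib, h5, Finset.sum_neg_distrib, ← Finset.sum_div, h4, div_div,
      mul_comm (12 : ℝ)]

lemma neg_quartic_le (hx : HasEmpiricalMoments x a b) (s : ℝ) :
    -(b * s ^ 4 / (12 * a ^ 2)) ≤ (1 - s ^ 2) / 40 := by
  refine le_of_tendsto (hx.tendsto_sum_logCoshDefect s) ?_
  filter_upwards [hx.eventually_T_pos] with n ⟨hn, hT⟩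
  exact sum_logCoshDefect_le (one_le_rpow_quarter hn) (rpow_quarter_pow_four n) hT s

lemma tendsto_symmetrizedMean (hx : HasEmpiricalMoments x a b)
    (f : BoundedContinuousFunction ℝ ℝ) :
    Tendsto (fun n : ℕ => symmetrizedMean f ((n : ℝ) ^ (1 / 4 : ℝ)) n fun i => x i) atTop
      (𝓝 (∫ s, f s * exp (-(b * s ^ 4 / (12 * a ^ 2))))) := by
  have h : Tendsto (fun n : ℕ => ∫ s, f s * exp (∑ i : Fin n,
      logCoshDefect ((n : ℝ) ^ (1 / 4 : ℝ) * s * (x i / √(T n fun i => x i))))) atTop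
      (𝓝 (∫ s, f s * exp (-(b * s ^ 4 / (12 * a ^ 2))))) := by
    refine tendsto_integral_filter_of_dominated_convergence
      (fun s => ‖f‖ * exp ((1 - s ^ 2) / 40)) (Eventually.of_forall fun n => ?_) ?_
      (integrable_exp_quadratic.const_mul _) (ae_of_all _ fun s => ?_)
    · refine Continuous.aestronglyMeasurable (f.continuous.mul (continuous_exp.comp ?_))
      exact continuous_finsetSum _ fun i _ => continuous_logCoshDefect.comp (by fun_prop)
    · filter_upwards [hx.eventually_T_pos] with n ⟨hn, hT⟩
      exact ae_of_all _ (norm_mul_exp_sum_le f (one_le_rpow_quarter hn)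
        (rpow_quarter_pow_four n) hT)
    · exact ((continuous_exp.tendsto _).comp (hx.tendsto_sum_logCoshDefect s)).const_mul _
  refine h.congr' ?_
  filter_upwards [hx.eventually_T_pos] with n ⟨_, hT⟩
  rw [symmetrizedMean, if_pos hT]

end HasEmpiricalMoments

lemma integrable_pow_of_integrable_abs_pow {ρ : Measure ℝ} [IsFiniteMeasure ρ] {p k : ℕ}
    (hp : Integrable (fun x : ℝ => |x| ^ p) ρ) (hk : k ≤ p) :
    Integrable (fun x : ℝ => x ^ k) ρ := by
  refine ((integrable_const (1 : ℝ)).add hp).mono' (by fun_prop) (ae_of_all _ fun x => ?_)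
  rw [norm_pow, Real.norm_eq_abs]
  change |x| ^ k ≤ 1 + |x| ^ p
  rcases le_total |x| 1 with h | h
  · have := pow_le_one₀ (n := k) (abs_nonneg x) h
    have : 0 ≤ |x| ^ p := by positivity
    linarith
  · have := pow_le_pow_right₀ h hk
    linarith

lemma ae_tendsto_empirical_mean (ρ : Measure ℝ) [IsProbabilityMeasure ρ] {g : ℝ → ℝ}
    (hg : Measurable g) (hint : Integrable g ρ) :
    ∀ᵐ x ∂(Measure.infinitePi fun _ : ℕ => ρ),
      Tendsto (fun n : ℕ => (∑ i ∈ Finset.range n, g (x i)) / n) atTop (𝓝 (∫ y, g y ∂ρ)) := by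
  have hev : ∀ i, (Measure.infinitePi fun _ : ℕ => ρ).map (fun x => x i) = ρ := fun i =>
    Measure.infinitePi_map_eval (fun _ : ℕ => ρ) i
  have hmean : ∫ x, g (x 0) ∂(Measure.infinitePi fun _ : ℕ => ρ) = ∫ y, g y ∂ρ := by
    conv_rhs => rw [← hev 0]
    rw [integral_map (measurable_pi_apply 0).aemeasurable hg.aestronglyMeasurable]
  have hcomp : ∀ i : ℕ, Measurable fun x : ℕ → ℝ => x i := fun i => measurable_pi_apply i
  rw [← hmean]
  refine strong_law_ae_real (fun (i : ℕ) (x : ℕ → ℝ) => g (x i)) ?_ ?_ fun i => ?_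
  · exact (measurePreserving_eval_infinitePi (fun _ : ℕ => ρ) 0).integrable_comp_of_integrable hint
  · exact fun i j hij => (iIndepFun_infinitePi (P := fun _ : ℕ => ρ) (X := fun _ => g)
      fun _ => hg).indepFun hij
  · exact IdentDistrib.comp (u := g) ⟨(hcomp i).aemeasurable, (hcomp 0).aemeasurable,
      (hev i).trans (hev 0).symm⟩ hg

lemma infinitePi_map_fin (ρ : Measure ℝ) [IsProbabilityMeasure ρ] (n : ℕ) :
    (Measure.infinitePi fun _ : ℕ => ρ).map (fun x (i : Fin n) => x i) =
      Measure.pi fun _ => ρ := by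
  have h := (iIndepFun_infinitePi (P := fun _ : ℕ => ρ) (X := fun _ => id)
    fun _ => measurable_id).precomp (g := fun i : Fin n => (i : ℕ)) Fin.val_injective
  have hmeas : ∀ i : Fin n, Measurable fun x : ℕ → ℝ => id (x i) := fun i =>
    measurable_pi_apply (i : ℕ)
  refine (h.map_fun_eq_pi_map fun i => (hmeas i).aemeasurable).trans ?_
  congr 1
  funext i
  exact Measure.infinitePi_map_eval (fun _ : ℕ => ρ) i

lemma ae_hasEmpiricalMoments {ρ : Measure ℝ} [IsProbabilityMeasure ρ]
    (hne : ρ ≠ Measure.dirac 0) (h5 : Integrable (fun x : ℝ => |x| ^ 5) ρ) :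
    ∀ᵐ x ∂(Measure.infinitePi fun _ : ℕ => ρ),
      HasEmpiricalMoments x (∫ y, y ^ 2 ∂ρ) (∫ y, y ^ 4 ∂ρ) := by
  have h2 : Integrable (fun y : ℝ => y ^ 2) ρ :=
    integrable_pow_of_integrable_abs_pow h5 (by norm_num)
  have h4 : Integrable (fun y : ℝ => y ^ 4) ρ :=
    integrable_pow_of_integrable_abs_pow h5 (by norm_num)
  have hpos : 0 < ∫ y, y ^ 2 ∂ρ := by
    refine lt_of_le_of_ne (integral_nonneg fun y => sq_nonneg y) fun h0 => hne ?_
    rw [eq_comm, integral_eq_zero_iff_of_nonneg (fun y => sq_nonneg y) h2] at h0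
    have h1 : (fun y : ℝ => y) =ᵐ[ρ] fun _ => 0 := by
      filter_upwards [h0] with y hy
      simpa using hy
    have h3 : ρ.map (fun y => y) = ρ.map fun _ => 0 := Measure.map_congr h1
    rwa [Measure.map_id', Measure.map_const, measure_univ, one_smul] at h3
  filter_upwards [ae_tendsto_empirical_mean ρ (by fun_prop) h2,
    ae_tendsto_empirical_mean ρ (by fun_prop) h4,
    ae_tendsto_empirical_mean ρ (by fun_prop) h5] with x hx2 hx4 hx5
  exact ⟨hpos, hx2, hx4, _, hx5⟩

lemma tendsto_integral_symmetrizedMean {ρ : Measure ℝ} [IsProbabilityMeasure ρ]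
    (hne : ρ ≠ Measure.dirac 0) (h5 : Integrable (fun x : ℝ => |x| ^ 5) ρ)
    (f : BoundedContinuousFunction ℝ ℝ) :
    Tendsto (fun n : ℕ => ∫ x, symmetrizedMean f ((n : ℝ) ^ (1 / 4 : ℝ)) n x
      ∂(Measure.pi fun _ => ρ)) atTop
      (𝓝 (∫ s, f s * exp (-((∫ y, y ^ 4 ∂ρ) * s ^ 4 / (12 * (∫ y, y ^ 2 ∂ρ) ^ 2))))) := by
  have hmeas : ∀ n : ℕ, 1 ≤ n →
      StronglyMeasurable (symmetrizedMean f ((n : ℝ) ^ (1 / 4 : ℝ)) n) := fun n hn =>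
    stronglyMeasurable_symmetrizedMean f (zero_lt_one.trans_le (one_le_rpow_quarter hn))
  have hres : ∀ n : ℕ, Measurable fun (x : ℕ → ℝ) (i : Fin n) => x i := fun n => by fun_prop
  have h : Tendsto (fun n : ℕ => ∫ x, symmetrizedMean f ((n : ℝ) ^ (1 / 4 : ℝ)) n (fun i => x i)
      ∂(Measure.infinitePi fun _ : ℕ => ρ)) atTop
      (𝓝 (∫ _, (∫ s, f s * exp (-((∫ y, y ^ 4 ∂ρ) * s ^ 4 / (12 * (∫ y, y ^ 2 ∂ρ) ^ 2))))
        ∂(Measure.infinitePi fun _ : ℕ => ρ))) := by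
    refine tendsto_integral_filter_of_dominated_convergence
      (fun _ => ∫ s : ℝ, ‖f‖ * exp ((1 - s ^ 2) / 40)) ?_ ?_ (integrable_const _) ?_
    · filter_upwards [eventually_ge_atTop 1] with n hn
      exact ((hmeas n hn).comp_measurable (hres n)).aestronglyMeasurable
    · filter_upwards [eventually_ge_atTop 1] with n hn
      exact ae_of_all _ fun x => norm_symmetrizedMean_le f (one_le_rpow_quarter hn)
        (rpow_quarter_pow_four n) _
    · filter_upwards [ae_hasEmpiricalMoments hne h5] with x hx
      exact hx.tendsto_symmetrizedMean f
  rw [integral_const, probReal_univ, one_smul] at h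
  refine h.congr' ?_
  filter_upwards [eventually_ge_atTop 1] with n hn
  rw [← infinitePi_map_fin ρ n, integral_map (hres n).aemeasurable (hmeas n hn).aestronglyMeasurable]

lemma integral_exp_quartic_pos {ρ : Measure ℝ} [IsProbabilityMeasure ρ]
    (hne : ρ ≠ Measure.dirac 0) (h5 : Integrable (fun x : ℝ => |x| ^ 5) ρ) :
    0 < ∫ s, exp (-((∫ y, y ^ 4 ∂ρ) * s ^ 4 / (12 * (∫ y, y ^ 2 ∂ρ) ^ 2))) := by
  obtain ⟨x, hx⟩ := (ae_hasEmpiricalMoments hne h5).exists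
  refine integral_exp_pos (integrable_exp_quadratic.mono'
    (Continuous.aestronglyMeasurable (by fun_prop)) (ae_of_all _ fun s => ?_))
  rw [Real.norm_of_nonneg (exp_pos _).le, exp_le_exp]
  exact hx.neg_quartic_le s

lemma variance_eq_integral_sq {ρ : Measure ℝ} (hsymm : ρ.map (fun x => -x) = ρ) :
    variance id ρ = ∫ y, y ^ 2 ∂ρ := by
  refine variance_of_integral_eq_zero aemeasurable_id ?_
  have h : ∫ x, id x ∂ρ = ∫ x, -id x ∂ρ := by
    conv_lhs => rw [← hsymm]
    rw [integral_map (by fun_prop) (by fun_prop)]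
    rfl
  rw [integral_neg] at h
  linarith

lemma Z_eq_integral_tiltedMean (ρ : Measure ℝ) (n : ℕ) (q : ℝ) :
    Z ρ n = ∫ x, tiltedMean (BoundedContinuousFunction.const ℝ (1 : ℝ)) q n x
      ∂(Measure.pi fun _ => ρ) := by
  simp [Z, tiltedMean]

lemma integrable_weight (ρ : Measure ℝ) [IsProbabilityMeasure ρ] (n : ℕ) :
    Integrable (weight n) (Measure.pi fun _ => ρ) :=
  Integrable.of_bound measurable_weight.aestronglyMeasurable (exp (n / 2)) <|
    ae_of_all _ fun x => by rw [Real.norm_of_nonneg (weight_nonneg x)]; exact weight_le x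

lemma integral_tildeMu_prod_gaussianReal (ρ : Measure ℝ) [IsProbabilityMeasure ρ] {n : ℕ}
    (hZ : 0 < Z ρ n) (f : BoundedContinuousFunction ℝ ℝ) (q : ℝ) :
    ∫ p : (Fin n → ℝ) × ℝ, f (p.2 / q + S n p.1 / (q * √(T n p.1)))
        ∂((tildeMu ρ n).prod (gaussianReal 0 1)) =
      (Z ρ n)⁻¹ * ∫ x, tiltedMean f q n x ∂(Measure.pi fun _ => ρ) := by
  have hS := @measurable_S n
  have hT := @measurable_T n
  have hf := f.continuous.measurable
  have hm : Measurable fun p : (Fin n → ℝ) × ℝ => f (p.2 / q + S n p.1 / (q * √(T n p.1))) := by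
    fun_prop
  have hfin : IsFiniteMeasure (tildeMu ρ n) := by
    have := isFiniteMeasure_withDensity_ofReal (integrable_weight ρ n).hasFiniteIntegral
    exact Measure.smul_finite _ (by simpa using hZ)
  rw [integral_prod _ (Integrable.of_bound hm.aestronglyMeasurable ‖f‖
      (ae_of_all _ fun p => f.norm_coe_le_norm _)), tildeMu, integral_smul_measure,
    integral_withDensity_eq_integral_toReal_smul measurable_weight.ennreal_ofReal
      (ae_of_all _ fun x => ENNReal.ofReal_lt_top)]
  simp only [ENNReal.toReal_inv, ENNReal.toReal_ofReal hZ.le, smul_eq_mul,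
    ENNReal.toReal_ofReal (weight_nonneg _)]
  rfl

/-- if `ρ` is a symmetric probability measure on `ℝ`, not the Dirac mass
at `0`, with a finite fifth moment, variance `σ²` and fourth moment `μ₄`, and if, for
each `n`, `(Xₙ¹, …, Xₙⁿ)` has law `μ̃_{n,ρ}` and `W` is a standard Gaussian random
variable independent of it (so that the pair has law `μ̃_{n,ρ} ⊗ N(0,1)`), then
`W/n^{1/4} + Sₙ/(n^{1/4}√Tₙ)` converges in distribution to the probability measure
on `ℝ` with density `s ↦ (∫_ℝ exp(−μ₄ z⁴/(12σ⁴)) dz)⁻¹ exp(−μ₄ s⁴/(12σ⁴))`. -/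
theorem fluctuations_with_gaussian
    (ρ : Measure ℝ) [IsProbabilityMeasure ρ]
    (hsymm : ρ.map (fun x => -x) = ρ)
    (hne : ρ ≠ Measure.dirac 0)
    (h5 : Integrable (fun x : ℝ => |x| ^ 5) ρ)
    (σ2 μ4 : ℝ)
    (hσ2 : σ2 = ProbabilityTheory.variance id ρ)
    (hμ4 : μ4 = ∫ x : ℝ, x ^ 4 ∂ρ) :
    ∀ f : BoundedContinuousFunction ℝ ℝ,
      Tendsto
        (fun n : ℕ =>
          ∫ p : (Fin n → ℝ) × ℝ,
            f (p.2 / (n : ℝ) ^ (1/4 : ℝ) +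
              S n p.1 / ((n : ℝ) ^ (1/4 : ℝ) * Real.sqrt (T n p.1)))
            ∂((tildeMu ρ n).prod (gaussianReal 0 1)))
        atTop
        (𝓝 (∫ s : ℝ, f s *
          ((∫ z : ℝ, Real.exp (-(μ4 * z ^ 4 / (12 * σ2 ^ 2))))⁻¹ *
            Real.exp (-(μ4 * s ^ 4 / (12 * σ2 ^ 2)))))) := by
  intro f
  rw [variance_eq_integral_sq hsymm] at hσ2
  subst hσ2 hμ4
  set L := fun s : ℝ => exp (-((∫ y, y ^ 4 ∂ρ) * s ^ 4 / (12 * (∫ y, y ^ 2 ∂ρ) ^ 2)))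
  have hL : 0 < ∫ s, L s := integral_exp_quartic_pos hne h5
  have hone : Tendsto (fun n : ℕ => ∫ x, symmetrizedMean
      (BoundedContinuousFunction.const ℝ (1 : ℝ)) ((n : ℝ) ^ (1 / 4 : ℝ)) n x
      ∂(Measure.pi fun _ => ρ)) atTop (𝓝 (∫ s, L s)) := by
    simpa [L] using
      tendsto_integral_symmetrizedMean hne h5 (BoundedContinuousFunction.const ℝ (1 : ℝ))
  have hlim : ∫ s, f s * ((∫ z, L z)⁻¹ * L s) = (∫ s, f s * L s) / ∫ s, L s := by
    rw [← integral_div]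
    congr 1
    funext s
    ring
  rw [hlim]
  refine ((tendsto_integral_symmetrizedMean hne h5 f).div hone hL.ne').congr' ?_
  filter_upwards [hone.eventually_const_lt hL, eventually_ge_atTop 1] with n hpos hn
  have hq : 0 < (n : ℝ) ^ (1 / 4 : ℝ) := zero_lt_one.trans_le (one_le_rpow_quarter hn)
  have hZ := Z_eq_integral_tiltedMean ρ n ((n : ℝ) ^ (1 / 4 : ℝ))
  rw [integral_tiltedMean hsymm _ hq] at hZ
  have hc : 0 < (n : ℝ) ^ (1 / 4 : ℝ) / √(2 * π) := by positivity
  rw [integral_tildeMu_prod_gaussianReal ρ (by rw [hZ]; positivity) f,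
    integral_tiltedMean hsymm f hq, hZ, ← div_eq_inv_mul, mul_div_mul_left _ _ hc.ne']
  rfl
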